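/- arXiv:1309.3441 — 2 statements merged into one kernel-verified Lean document; each statement's English description precedes it below -/
import Mathlib

section
/- Let w be a right-infinite word over a finite alphabet, let n ≥ 1, and let c be the number of distinct subwords of w of length n that have valence 1. If w has a subword u of length n + c all of whose subwords of length n have valence 1 in w, then w is ultimately periodic. -/
/-- A finite word `u` is a subword (factor) of the right-infinite word `w` if
it occurs as a contiguous block of consecutive letters of `w`. -/
def IsFactor {A : Type*} (w : ℕ → A) (u : List A) : Prop :=
  ∃ i : ℕ, u = (List.range u.length).map fun j => w (i + j)

/-- The valence of a finite word `u` in the right-infinite word `w`: the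
number of distinct letters `a` such that `u ++ [a]` is a subword of `w`. -/
noncomputable def ivalence {A : Type*} (w : ℕ → A) (u : List A) : ℕ :=
  Set.ncard {a : A | IsFactor w (u ++ [a])}

/-- A right-infinite word is ultimately periodic if from some point on it is
periodic with some period `p ≥ 1`. -/
def UltimatelyPeriodic {A : Type*} (w : ℕ → A) : Prop :=
  ∃ p, 1 ≤ p ∧ ∃ M, ∀ i, M ≤ i → w (i + p) = w i

/-- The block of length `n` of `w` starting at position `i`. -/
def block {A : Type*} (w : ℕ → A) (n i : ℕ) : List A :=
  (List.range n).map fun j => w (i + j)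

@[simp]
theorem length_block {A : Type*} (w : ℕ → A) (n i : ℕ) : (block w n i).length = n := by
  simp [block]

theorem block_succ {A : Type*} (w : ℕ → A) (n i : ℕ) :
    block w (n + 1) i = block w n i ++ [w (i + n)] := by
  simp [block, List.range_succ]

theorem block_succ' {A : Type*} (w : ℕ → A) (n i : ℕ) :
    block w (n + 1) i = w i :: block w n (i + 1) := by
  simp [block, List.range_succ_eq_map, Function.comp_def, Nat.add_assoc, Nat.add_comm 1]

theorem block_add {A : Type*} (w : ℕ → A) (m n i : ℕ) :
    block w (m + n) i = block w m i ++ block w n (i + m) := by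
  simp [block, List.range_add, Function.comp_def, Nat.add_assoc]

theorem isFactor_block {A : Type*} (w : ℕ → A) (n i : ℕ) : IsFactor w (block w n i) :=
  ⟨i, by rw [length_block]; rfl⟩

/-- Equal blocks of valence `1` are followed by the same letter. -/
theorem next_eq_of_block_eq {A : Type*} {w : ℕ → A} {n x y : ℕ}
    (h : block w n x = block w n y) (hv : ivalence w (block w n x) = 1) :
    w (x + n) = w (y + n) := by
  obtain ⟨a, ha⟩ := Set.ncard_eq_one.mp hv
  have hx : w (x + n) ∈ {a : A | IsFactor w (block w n x ++ [a])} := by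
    rw [Set.mem_ofPred_eq, ← block_succ]
    exact isFactor_block w _ _
  have hy : w (y + n) ∈ {a : A | IsFactor w (block w n x ++ [a])} := by
    rw [Set.mem_ofPred_eq, h, ← block_succ]
    exact isFactor_block w _ _
  rw [ha] at hx hy
  exact hx.trans hy.symm

/-- Equal blocks of valence `1` have equal successor blocks. -/
theorem block_succ_eq_of_block_eq {A : Type*} {w : ℕ → A} {n x y : ℕ}
    (h : block w n x = block w n y) (hv : ivalence w (block w n x) = 1) :
    block w n (x + 1) = block w n (y + 1) := by
  have e : block w (n + 1) x = block w (n + 1) y := by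
    rw [block_succ, block_succ, h, next_eq_of_block_eq h hv]
  rw [block_succ', block_succ'] at e
  exact (List.cons.inj e).2

/-- If a block recurs after `d` steps and the `d` blocks in between have valence `1`, then the
word is ultimately periodic. -/
theorem ultimatelyPeriodic_of_block_eq {A : Type*} {w : ℕ → A} {n p d : ℕ} (hd : 1 ≤ d)
    (h : block w n (p + d) = block w n p)
    (hv : ∀ k < d, ivalence w (block w n (p + k)) = 1) : UltimatelyPeriodic w := by
  have key : ∀ k, block w n (p + k + d) = block w n (p + k) ∧
      ivalence w (block w n (p + k)) = 1 := by
    intro k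
    induction k using Nat.strong_induction_on with
    | _ k ih =>
      constructor
      · cases k with
        | zero => exact h
        | succ k =>
          obtain ⟨h1, h2⟩ := ih k k.lt_succ_self
          have := block_succ_eq_of_block_eq h1.symm h2
          rw [show p + (k + 1) + d = p + k + d + 1 by omega]
          exact this.symm
      · by_cases hk : k < d
        · exact hv k hk
        · obtain ⟨h1, h2⟩ := ih (k - d) (by omega)
          rw [show p + (k - d) + d = p + k by omega] at h1
          rw [h1, h2]
  refine ⟨d, hd, p + n, fun i hi => ?_⟩
  obtain ⟨k, rfl⟩ := Nat.exists_eq_add_of_le hi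
  obtain ⟨h1, h2⟩ := key k
  have := next_eq_of_block_eq h1.symm h2
  rw [show p + n + k + d = p + k + d + n by omega, show p + n + k = p + k + n by omega]
  exact this.symm

/-- Let `w` be a right-infinite word, `n ≥ 1`, and `c` the number of distinct
subwords of `w` of length `n` having valence `1`. If `w` has a subword `u` of
length `n + c` all of whose subwords of length `n` have valence `1` in `w`,
then `w` is ultimately periodic. -/
theorem ultimatelyPeriodic_of_valence_one_block {A : Type*} [Fintype A]
    (w : ℕ → A) (n : ℕ) (hn : 1 ≤ n) (c : ℕ)
    (hc : c = Set.ncard {u : List A | u.length = n ∧ IsFactor w u ∧ ivalence w u = 1})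
    (u : List A) (hu : IsFactor w u) (hlen : u.length = n + c)
    (hval : ∀ v : List A, v <:+: u → v.length = n → ivalence w v = 1) :
    UltimatelyPeriodic w := by
  obtain ⟨i, hi⟩ := hu
  rw [hlen] at hi
  change u = block w (n + c) i at hi
  have hv : ∀ k ≤ c, ivalence w (block w n (i + k)) = 1 := by
    intro k hk
    refine hval _ ⟨block w k i, block w (c - k) (i + (k + n)), ?_⟩ (length_block _ _ _)
    rw [hi, ← block_add, ← block_add]
    congr 1
    omega
  have hfin : {u : List A | u.length = n ∧ IsFactor w u ∧ ivalence w u = 1}.Finite :=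
    (List.finite_length_eq A n).subset fun _ hx => hx.1
  obtain ⟨a, ha, b, hb, hab, heq⟩ :
      ∃ a ∈ Set.Iic c, ∃ b ∈ Set.Iic c, a ≠ b ∧ block w n (i + a) = block w n (i + b) := by
    refine Set.exists_ne_map_eq_of_ncard_lt_of_maps_to
      (t := {u : List A | u.length = n ∧ IsFactor w u ∧ ivalence w u = 1}) ?_
      (fun k hk => ⟨length_block _ _ _, isFactor_block _ _ _, hv k hk⟩) hfin
    rw [← hc, ← Finset.coe_Iic, Set.ncard_coe_finset, Nat.card_Iic]
    exact c.lt_succ_self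
  wlog hlt : a < b generalizing a b
  · exact this b hb a ha hab.symm heq.symm (by omega)
  rw [Set.mem_Iic] at ha hb
  refine ultimatelyPeriodic_of_block_eq (p := i + a) (d := b - a) (n := n) (by omega) ?_ ?_
  · rw [heq]
    congr 1
    omega
  · intro k hk
    rw [Nat.add_assoc]
    exact hv _ (by omega)
end

section
/- Let w be a nonempty finite Sturmian word of length N (i.e., a nonempty finite word over {0,1} that occurs as a subword of some infinite Sturmian word). Then N = R_w + K_w, where R_w is the minimal n such that every subword of w of length n has valence at most 1, and K_w is the minimal length of a suffix of w that occurs only once in w. -/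
/-- The subword complexity of a right-infinite word `w`: the number of
distinct subwords of `w` of length `n`. -/
noncomputable def icomplexity {A : Type*} (w : ℕ → A) (n : ℕ) : ℕ :=
  Set.ncard {u : List A | u.length = n ∧ IsFactor w u}

/-- The valence of a word `u` in a finite word `w`: the number of distinct
letters `a` such that `u ++ [a]` is a subword of `w`. -/
noncomputable def valence {A : Type*} (w u : List A) : ℕ :=
  Set.ncard {a : A | (u ++ [a]) <:+: w}

/-- The number of occurrences of `u` in `w`: the number of starting positions
`i` at which the contiguous block of `w` of length `|u|` equals `u`. -/
noncomputable def occCount {A : Type*} (w u : List A) : ℕ :=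
  Set.ncard {i : ℕ | i + u.length ≤ w.length ∧ (w.drop i).take u.length = u}

/-- The words of length `n` in the set of words `P`. -/
def wordsOfLength (P : List Bool → Prop) (n : ℕ) : Set (List Bool) :=
  {u | u.length = n ∧ P u}

/-- The words of length `n` in `P` both of whose one-letter right extensions lie in `P`. -/
def rightSpecial (P : List Bool → Prop) (n : ℕ) : Set (List Bool) :=
  {u | u.length = n ∧ P (u ++ [true]) ∧ P (u ++ [false])}

/-- The words of length `n` in `P` without a one-letter right extension in `P`. -/
def rightMaximal (P : List Bool → Prop) (n : ℕ) : Set (List Bool) :=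
  {u | u.length = n ∧ P u ∧ ∀ a, ¬ P (u ++ [a])}

theorem finite_of_length_eq {s : Set (List Bool)} {n : ℕ} (h : ∀ u ∈ s, u.length = n) :
    s.Finite :=
  (List.finite_length_eq Bool n).subset h

theorem ncard_wordsOfLength_succ {P : List Bool → Prop}
    (hP : ∀ u a, P (u ++ [a]) → P u) (n : ℕ) :
    (wordsOfLength P (n + 1)).ncard + (rightMaximal P n).ncard =
      (wordsOfLength P n).ncard + (rightSpecial P n).ncard := by
  let E (a : Bool) : Set (List Bool) := {u | u.length = n ∧ P (u ++ [a])}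
  have hE (a : Bool) : (E a).Finite := finite_of_length_eq fun u hu => hu.1
  have hinj (a : Bool) : Function.Injective (fun u : List Bool => u ++ [a]) :=
    fun u v h => List.append_cancel_right h
  have h1 : wordsOfLength P (n + 1) =
      (fun u => u ++ [true]) '' E true ∪ (fun u => u ++ [false]) '' E false := by
    ext u
    constructor
    · rintro ⟨hu, hPu⟩
      rcases List.eq_nil_or_concat u with rfl | ⟨v, a, rfl⟩
      · simp at hu
      · have hv : v.length = n := by simpa using hu
        cases a
        · exact Or.inr ⟨v, ⟨hv, by simpa using hPu⟩, by simp⟩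
        · exact Or.inl ⟨v, ⟨hv, by simpa using hPu⟩, by simp⟩
    · rintro (⟨v, ⟨hv, hPv⟩, rfl⟩ | ⟨v, ⟨hv, hPv⟩, rfl⟩) <;>
        exact ⟨by simp [hv], hPv⟩
  have hd : Disjoint ((fun u => u ++ [true]) '' E true) ((fun u => u ++ [false]) '' E false) := by
    rw [Set.disjoint_left]
    rintro _ ⟨u, -, rfl⟩ ⟨v, -, h⟩
    simpa using congrArg List.getLast? h
  have h2 : wordsOfLength P n = (E true ∪ E false) ∪ rightMaximal P n := by
    ext u
    simp only [wordsOfLength, rightMaximal, E, Set.mem_union, Set.mem_ofPred_eq, Bool.forall_bool]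
    have := hP u true
    have := hP u false
    tauto
  have hd2 : Disjoint (E true ∪ E false) (rightMaximal P n) := by
    rw [Set.disjoint_left]
    rintro u (hu | hu) hz
    exacts [hz.2.2 _ hu.2, hz.2.2 _ hu.2]
  have h3 : rightSpecial P n = E true ∩ E false := by
    ext u
    simp only [rightSpecial, E, Set.mem_inter_iff, Set.mem_ofPred_eq]
    tauto
  rw [h1, Set.ncard_union_eq hd ((hE _).image _) ((hE _).image _),
    Set.ncard_image_of_injective _ (hinj _), Set.ncard_image_of_injective _ (hinj _), h2,
    Set.ncard_union_eq hd2 ((hE _).union (hE _)) (finite_of_length_eq fun u hu => hu.1), h3,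
    ← Set.ncard_union_add_ncard_inter _ _ (hE _) (hE _)]
  ring

theorem isFactor_iff_getElem {A : Type*} {W : ℕ → A} {u : List A} :
    IsFactor W u ↔ ∃ i, ∀ j (h : j < u.length), u[j] = W (i + j) := by
  refine exists_congr fun i => ⟨fun h j hj => ?_, fun h => ?_⟩
  · have := List.getElem_of_eq h hj
    simpa using this
  · apply List.ext_getElem <;> simp +contextual [h]

theorem IsFactor.of_infix {A : Type*} {W : ℕ → A} {u w : List A} (hw : IsFactor W w)
    (h : u <:+: w) : IsFactor W u := by
  rw [isFactor_iff_getElem] at hw ⊢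
  obtain ⟨i, hi⟩ := hw
  obtain ⟨s, t, rfl⟩ := h
  refine ⟨i + s.length, fun j hj => ?_⟩
  have := hi (s.length + j) (by simp; omega)
  rw [add_assoc, ← this]
  simp [hj]

theorem IsFactor.exists_append {A : Type*} {W : ℕ → A} {u : List A} (hu : IsFactor W u) :
    ∃ a, IsFactor W (u ++ [a]) := by
  obtain ⟨i, hi⟩ := hu
  refine ⟨W (i + u.length), i, ?_⟩
  rw [List.length_append, List.length_singleton, List.range_succ, List.map_append, ← hi]
  rfl

theorem ncard_rightSpecial_isFactor_le_one {W : ℕ → Bool}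
    (hW : ∀ n, 1 ≤ n → icomplexity W n = n + 1) (n : ℕ) :
    (rightSpecial (IsFactor W) n).ncard ≤ 1 := by
  rcases Nat.eq_zero_or_pos n with rfl | hn
  · refine (Set.ncard_le_one_iff (finite_of_length_eq fun u hu => hu.1)).2 fun {a b} ha hb => ?_
    rw [List.eq_nil_of_length_eq_zero ha.1, List.eq_nil_of_length_eq_zero hb.1]
  · have h := ncard_wordsOfLength_succ
      (fun u a (h : IsFactor W (u ++ [a])) => h.of_infix (List.infix_append' [] u [a])) n
    have h0 : rightMaximal (IsFactor W) n = ∅ :=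
      Set.eq_empty_iff_forall_notMem.2 fun u hu =>
        let ⟨a, ha⟩ := hu.2.1.exists_append
        hu.2.2 a ha
    rw [h0, Set.ncard_empty] at h
    have h1 : (wordsOfLength (IsFactor W) n).ncard = n + 1 := hW n hn
    have h2 : (wordsOfLength (IsFactor W) (n + 1)).ncard = n + 1 + 1 := hW (n + 1) (by omega)
    omega

theorem infix_of_append_infix {A : Type*} {u v w : List A} (h : u ++ v <:+: w) : u <:+: w :=
  (List.prefix_append u v).isInfix.trans h

theorem valence_le_one_iff {w u : List Bool} :
    valence w u ≤ 1 ↔ ¬ (u ++ [true] <:+: w ∧ u ++ [false] <:+: w) := by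
  rw [valence, Set.ncard_le_one_iff]
  constructor
  · rintro h ⟨ht, hf⟩
    exact absurd (h ht hf) (by decide)
  · rintro h (_ | _) (_ | _) ha hb
    exacts [rfl, (h ⟨hb, ha⟩).elim, (h ⟨ha, hb⟩).elim, rfl]

theorem forall_valence_le_one_iff {w : List Bool} {n : ℕ} :
    (∀ u : List Bool, u.length = n → u <:+: w → valence w u ≤ 1) ↔
      rightSpecial (· <:+: w) n = ∅ := by
  simp only [valence_le_one_iff, Set.eq_empty_iff_forall_notMem]
  exact ⟨fun h u hu => h u hu.1 (infix_of_append_infix hu.2.1) hu.2,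
    fun h u hu _ hs => h u ⟨hu, hs⟩⟩

theorem rightSpecial_infix_eq_empty_mono {w : List Bool} {m n : ℕ} (hmn : m ≤ n)
    (h : rightSpecial (· <:+: w) m = ∅) : rightSpecial (· <:+: w) n = ∅ := by
  rw [Set.eq_empty_iff_forall_notMem] at h ⊢
  rintro u ⟨hu, ht, hf⟩
  have hdrop (a : Bool) : u.drop (n - m) ++ [a] <:+ u ++ [a] :=
    (List.suffix_append_inj_of_length_eq rfl).2 ⟨List.drop_suffix _ _, rfl⟩
  exact h (u.drop (n - m))
    ⟨by simp; omega, (hdrop _).isInfix.trans ht, (hdrop _).isInfix.trans hf⟩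

theorem occCount_eq_one_iff {w u : List Bool} (hu : u <:+ w) :
    occCount w u = 1 ↔ ∀ a, ¬ u ++ [a] <:+: w := by
  obtain ⟨s, rfl⟩ := hu
  have hs : s.length ∈ {i : ℕ | i + u.length ≤ (s ++ u).length ∧
      ((s ++ u).drop i).take u.length = u} := by simp
  rw [occCount, Set.ncard_eq_one]
  constructor
  · rintro ⟨x, hx⟩ a ⟨p, q, hpq⟩
    have hp : p.length ∈ {i : ℕ | i + u.length ≤ (s ++ u).length ∧
        ((s ++ u).drop i).take u.length = u} := by
      rw [← hpq]
      simp
    rw [hx] at hs hp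
    have := congrArg List.length hpq
    simp only [List.length_append, List.length_singleton] at this
    rw [Set.mem_singleton_iff] at hs hp
    omega
  · refine fun h => ⟨s.length, Set.eq_singleton_iff_unique_mem.2 ⟨hs, ?_⟩⟩
    rintro i ⟨hi, hiu⟩
    by_contra hne
    have hlt : i + u.length < (s ++ u).length := by
      simp only [List.length_append] at hi ⊢
      omega
    apply h ((s ++ u)[i + u.length])
    have hext : ((s ++ u).drop i).take (u.length + 1) = u ++ [(s ++ u)[i + u.length]] := by
      rw [List.take_add_one, hiu, List.getElem?_drop, List.getElem?_eq_getElem hlt]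
      rfl
    rw [← hext]
    exact (List.take_prefix _ _).isInfix.trans (List.drop_suffix _ _).isInfix

theorem suffix_of_infix_of_not_extendable {A : Type*} {w u : List A} (hu : u <:+: w)
    (h : ∀ a, ¬ u ++ [a] <:+: w) : u <:+ w := by
  obtain ⟨s, _ | ⟨a, t⟩, rfl⟩ := hu
  · exact ⟨s, by simp⟩
  · exact (h a ⟨s, t, by simp⟩).elim

theorem exists_suffix_occCount_iff {w : List Bool} {n : ℕ} :
    (∃ u : List Bool, u.length = n ∧ u <:+ w ∧ occCount w u = 1) ↔
      (rightMaximal (· <:+: w) n).Nonempty := by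
  refine exists_congr fun u => and_congr_right fun _ => ⟨fun h => ?_, fun h => ?_⟩
  · exact ⟨h.1.isInfix, (occCount_eq_one_iff h.1).1 h.2⟩
  · have hs := suffix_of_infix_of_not_extendable h.1 h.2
    exact ⟨hs, (occCount_eq_one_iff hs).2 h.2⟩

theorem ncard_rightMaximal_infix_le_one (w : List Bool) (n : ℕ) :
    (rightMaximal (· <:+: w) n).ncard ≤ 1 := by
  refine (Set.ncard_le_one_iff (finite_of_length_eq fun u hu => hu.1)).2 fun {u v} hu hv => ?_
  have hus := suffix_of_infix_of_not_extendable hu.2.1 hu.2.2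
  have hvs := suffix_of_infix_of_not_extendable hv.2.1 hv.2.2
  exact (List.suffix_of_suffix_length_le hus hvs (by rw [hu.1, hv.1])).eq_of_length
    (by rw [hu.1, hv.1])

theorem rightMaximal_infix_nonempty_mono {w : List Bool} {m n : ℕ} (hmn : m ≤ n)
    (hn : n ≤ w.length) (h : (rightMaximal (· <:+: w) m).Nonempty) :
    (rightMaximal (· <:+: w) n).Nonempty := by
  obtain ⟨u, hu, hui, hmax⟩ := h
  have hus := suffix_of_infix_of_not_extendable hui hmax
  have hd : w.drop (w.length - n) <:+ w := List.drop_suffix _ _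
  have hl : (w.drop (w.length - n)).length = n := by simp; omega
  obtain ⟨s, hs⟩ := List.suffix_of_suffix_length_le hus hd (by omega)
  refine ⟨_, hl, hd.isInfix, fun a ha => hmax a (List.IsInfix.trans ⟨s, [], ?_⟩ ha)⟩
  rw [← hs]
  simp

theorem ncard_wordsOfLength_infix {w : List Bool} {R K : ℕ}
    (hS : ∀ n, (rightSpecial (· <:+: w) n).ncard ≤ 1)
    (hR : IsLeast {n | rightSpecial (· <:+: w) n = ∅} R)
    (hK : IsLeast {n | (rightMaximal (· <:+: w) n).Nonempty} K) (n : ℕ) (hn : n ≤ w.length) :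
    (wordsOfLength (· <:+: w) n).ncard + (n - K) = 1 + min n R := by
  induction n with
  | zero =>
    have : wordsOfLength (· <:+: w) 0 = {[]} := by
      ext u
      simp only [wordsOfLength, Set.mem_ofPred_eq, List.length_eq_zero_iff, Set.mem_singleton_iff]
      exact ⟨fun h => h.1, fun h => ⟨h, h ▸ List.nil_infix⟩⟩
    simp [this]
  | succ n ih =>
    have hrec := ncard_wordsOfLength_succ (P := (· <:+: w)) (fun u a h => infix_of_append_infix h) n
    have hs : (rightSpecial (· <:+: w) n).ncard = if n < R then 1 else 0 := by
      split_ifs with h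
      · have hne : (rightSpecial (· <:+: w) n).Nonempty :=
          Set.nonempty_iff_ne_empty.2 fun he => absurd (hR.2 he) (by omega)
        have := (Set.ncard_pos (finite_of_length_eq fun u hu => hu.1)).2 hne
        have := hS n
        omega
      · rw [rightSpecial_infix_eq_empty_mono (not_lt.1 h) hR.1, Set.ncard_empty]
    have hz : (rightMaximal (· <:+: w) n).ncard = if K ≤ n then 1 else 0 := by
      split_ifs with h
      · have := (Set.ncard_pos (finite_of_length_eq fun u hu => hu.1)).2
          (rightMaximal_infix_nonempty_mono h (by omega) hK.1)
        have := ncard_rightMaximal_infix_le_one w n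
        omega
      · rw [Set.not_nonempty_iff_eq_empty.1 fun hne => h (hK.2 hne), Set.ncard_empty]
    have := ih (by omega)
    rw [hs, hz] at hrec
    split_ifs at hrec <;> omega

/-- Let `w` be a nonempty finite Sturmian word of length `N`, i.e. a nonempty
finite binary word occurring as a subword of some infinite Sturmian word.
Then `N = R + K`, where `R` is the minimal `n` such that every subword of `w`
of length `n` has valence at most `1`, and `K` is the minimal length of a
suffix of `w` occurring exactly once in `w`. -/
theorem finite_sturmian_R_add_K (w : List Bool) (hw : w ≠ [])
    (N : ℕ) (hN : w.length = N)
    (hSturm : ∃ W : ℕ → Bool,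
      (∀ n, 1 ≤ n → icomplexity W n = n + 1) ∧ IsFactor W w)
    (R K : ℕ)
    (hR : IsLeast {n | ∀ u : List Bool, u.length = n → u <:+: w → valence w u ≤ 1} R)
    (hK : IsLeast {m | ∃ u : List Bool, u.length = m ∧ u <:+ w ∧ occCount w u = 1} K) :
    N = R + K := by
  obtain ⟨W, hW, hwW⟩ := hSturm
  simp only [forall_valence_le_one_iff] at hR
  simp only [exists_suffix_occCount_iff] at hK
  have hS (n : ℕ) : (rightSpecial (· <:+: w) n).ncard ≤ 1 :=
    (Set.ncard_le_ncard (t := rightSpecial (IsFactor W) n)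
      (fun u hu => ⟨hu.1, hwW.of_infix hu.2.1, hwW.of_infix hu.2.2⟩)
      (finite_of_length_eq fun u hu => hu.1)).trans (ncard_rightSpecial_isFactor_le_one hW n)
  have hRN : R ≤ w.length := by
    refine hR.2 (Set.eq_empty_iff_forall_notMem.2 fun u hu => ?_)
    have := hu.2.1.length_le
    simp [hu.1] at this
  have hKN : K ≤ w.length := by
    obtain ⟨u, hu, hui, -⟩ := hK.1
    exact hu ▸ hui.length_le
  have hone : wordsOfLength (· <:+: w) w.length = {w} := by
    ext u
    exact ⟨fun h => h.2.eq_of_length h.1, fun h => h ▸ ⟨rfl, List.infix_rfl⟩⟩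
  have := ncard_wordsOfLength_infix hS hR hK w.length le_rfl
  rw [hone, Set.ncard_singleton] at this
  omega
end
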